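/- arXiv:0709.0910 — 3 statements merged into one kernel-verified Lean document; each statement's English description precedes it below -/
import Mathlib

section
/- Let n ≥ 3. Then the topological closure of Q_n equals the Minkowski sum P_n + C_n, i.e., closure(Q_n) = {Y + Z : Y ∈ P_n, Z ∈ C_n}. -/
open scoped BigOperators Pointwise

noncomputable def mmap {n : ℕ} (x : Fin n → ℝ) : Matrix (Fin n) (Fin n) ℝ :=
  fun k l => |x k - x l|

noncomputable def chi {n : ℕ} (U : Finset (Fin n)) : Fin n → ℝ :=
  fun j => if j ∈ U then 1 else 0

noncomputable def permVec {n : ℕ} (π : Equiv.Perm (Fin n)) : Fin n → ℝ :=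
  fun j => ((π j : ℕ) : ℝ) + 1

noncomputable def Mperm {n : ℕ} (π : Equiv.Perm (Fin n)) : Matrix (Fin n) (Fin n) ℝ :=
  mmap (permVec π)

def Npi {n : ℕ} (π : Equiv.Perm (Fin n)) : Set (Fin n → ℝ) :=
  {x | (∑ k, x k) = 0 ∧ ∀ k l : Fin n, π k < π l → x k ≤ x l}

def Ebn (n : ℕ) : Set (Matrix (Fin n) (Fin n) ℝ) :=
  {X | ∃ x : Fin n → ℝ, (∀ k l : Fin n, k ≠ l → 1 ≤ |x k - x l|) ∧ X = mmap x}

noncomputable def Qn (n : ℕ) : Set (Matrix (Fin n) (Fin n) ℝ) :=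
  convexHull ℝ (Ebn n)

noncomputable def Pn (n : ℕ) : Set (Matrix (Fin n) (Fin n) ℝ) :=
  convexHull ℝ {X | ∃ π : Equiv.Perm (Fin n), X = Mperm π}

noncomputable def cutCone (n : ℕ) : Set (Matrix (Fin n) (Fin n) ℝ) :=
  {X | ∃ lam : Finset (Fin n) → ℝ, (∀ U, 0 ≤ lam U) ∧
    X = ∑ U : Finset (Fin n), lam U • mmap (chi U)}

def incident {n : ℕ} (π : Equiv.Perm (Fin n)) (U : Finset (Fin n)) : Prop :=
  U.Nonempty ∧ U ≠ Finset.univ ∧ ∀ j, j ∈ U ↔ (π j : ℕ) + 1 ≤ U.card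

def overRidge {n : ℕ} (π : Equiv.Perm (Fin n)) (V : Finset (Fin n)) : Prop :=
  ∃ k : ℕ, 1 ≤ k ∧ k ≤ n - 1 ∧
    ∀ j, j ∈ V ↔ ((π j : ℕ) + 1 ≤ k - 1 ∨ (π j : ℕ) + 1 = k + 1)

noncomputable def halfline {n : ℕ} (π : Equiv.Perm (Fin n)) (U : Finset (Fin n)) :
    Set (Matrix (Fin n) (Fin n) ℝ) :=
  {X | ∃ t : ℝ, 0 ≤ t ∧ X = Mperm π + t • mmap (chi U)}

noncomputable def antipode {n : ℕ} (π : Equiv.Perm (Fin n)) : Equiv.Perm (Fin n) :=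
  π.trans Fin.revPerm

theorem mmap_mem_cutCone {n : ℕ} (y : Fin n → ℝ) (a : ℕ → ℝ) (ha : Monotone a)
    (r : Fin n → ℕ) (hr : ∀ j, r j < n) (hy : ∀ j, y j = a (r j)) : mmap y ∈ cutCone n := by
  classical
  let V : ℕ → Finset (Fin n) := fun i => Finset.univ.filter (fun j => i < r j)
  have key : mmap y = ∑ i ∈ Finset.range n, (a (i+1) - a i) • mmap (chi (V i)) := by
    have main : ∀ k l, r k ≤ r l → |y k - y l| =
        ∑ i ∈ Finset.range n, (a (i+1) - a i) * |chi (V i) k - chi (V i) l| := by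
      intro k l h
      have h1 : ∀ i ∈ Finset.range n, (a (i+1) - a i) * |chi (V i) k - chi (V i) l| =
          if i ∈ Finset.Ico (r k) (r l) then (a (i+1) - a i) else 0 := by
        intro i _
        simp only [chi, V, Finset.mem_filter, Finset.mem_univ, true_and, Finset.mem_Ico]
        by_cases h1 : i < r k
        · have h2 : i < r l := by omega
          have h3 : ¬ (r k ≤ i ∧ i < r l) := by omega
          simp [h1, h2]
        · by_cases h2 : i < r l
          · have h3 : (r k ≤ i ∧ i < r l) := by omega
            simp [h1, h2, h3]
          · simp [h1, h2]
      rw [Finset.sum_congr rfl h1, ← Finset.sum_filter]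
      have h2 : (Finset.range n).filter (fun i => i ∈ Finset.Ico (r k) (r l))
          = Finset.Ico (r k) (r l) := by
        ext i
        have := hr l
        simp only [Finset.mem_filter, Finset.mem_range, Finset.mem_Ico]
        omega
      rw [h2, Finset.sum_Ico_eq_sub _ h, Finset.sum_range_sub, Finset.sum_range_sub,
        hy, hy, abs_sub_comm, abs_of_nonneg (sub_nonneg.2 (ha h))]
      ring
    ext k l
    rw [Matrix.sum_apply]
    simp only [Matrix.smul_apply, smul_eq_mul, mmap]
    rcases le_total (r k) (r l) with h | h
    · exact main k l h
    · rw [abs_sub_comm, main l k h]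
      exact Finset.sum_congr rfl fun i _ => by rw [abs_sub_comm]
  refine ⟨fun U => ∑ i ∈ Finset.range n, if V i = U then (a (i+1) - a i) else 0, ?_, ?_⟩
  · intro U
    refine Finset.sum_nonneg fun i _ => ?_
    split_ifs
    · exact sub_nonneg.2 (ha (Nat.le_succ i))
    · exact le_rfl
  · rw [key]
    simp only [Finset.sum_smul]
    rw [Finset.sum_comm]
    refine Finset.sum_congr rfl fun i _ => ?_
    simp [ite_smul]

theorem convex_cutCone (n : ℕ) : Convex ℝ (cutCone n) := by
  rintro _ ⟨l, hl, rfl⟩ _ ⟨m, hm, rfl⟩ a b ha hb _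
  refine ⟨fun U => a * l U + b * m U, fun U => ?_, ?_⟩
  · have := hl U
    have := hm U
    positivity
  · simp only [Finset.smul_sum, ← Finset.sum_add_distrib, add_smul, mul_smul]

theorem continuous_mmap (n : ℕ) : Continuous (mmap : (Fin n → ℝ) → _) := by
  unfold mmap
  refine continuous_matrix fun i j => ?_
  fun_prop

theorem isClosed_cutCone (n : ℕ) : IsClosed (cutCone n) := by
  classical
  let f : (Finset (Fin n) → ℝ) → Matrix (Fin n) (Fin n) ℝ :=
    fun lam => ∑ U : Finset (Fin n), lam U • mmap (chi U)
  have hf : Continuous f := by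
    refine continuous_finsetSum _ fun U _ => ?_
    exact (continuous_apply U).smul continuous_const
  let s : Matrix (Fin n) (Fin n) ℝ → ℝ := fun X => ∑ i, ∑ j, X i j
  have hs : Continuous s := by
    refine continuous_finsetSum _ fun i _ => continuous_finsetSum _ fun j _ => ?_
    exact continuous_id.matrix_elem i j
  -- image of boxes
  let B : ℝ → Set (Finset (Fin n) → ℝ) := fun K => Set.univ.pi fun _ => Set.Icc 0 K
  have hB : ∀ K, IsClosed (f '' B K) := fun K =>
    ((isCompact_univ_pi fun _ => isCompact_Icc).image hf).isClosed
  have hBC : ∀ K, f '' B K ⊆ cutCone n := by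
    rintro K _ ⟨l, hl, rfl⟩
    exact ⟨l, fun U => (hl U trivial).1, rfl⟩
  have hCB : ∀ K, 0 ≤ K → ∀ X ∈ cutCone n, s X < K → X ∈ f '' B K := by
    rintro K hK X ⟨l, hl, rfl⟩ hX
    have h0 : ∀ U : Finset (Fin n), mmap (chi U) ≠ 0 → l U ≤ K := by
      intro U hU
      have : ∃ i j, mmap (chi U) i j ≠ 0 := by
        by_contra! h
        exact hU (by ext i j; exact h i j)
      obtain ⟨i, j, hij⟩ := this
      have h1 : mmap (chi U) i j = 1 := by
        revert hij
        simp only [mmap, chi]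
        split_ifs <;> simp
      have nn : ∀ i j, ∀ W, 0 ≤ l W * mmap (chi W) i j := fun i j W =>
        mul_nonneg (hl W) (abs_nonneg _)
      have e : ∀ i j, (∑ W, l W • mmap (chi W)) i j = ∑ W, l W * mmap (chi W) i j := by
        intro i j
        rw [Matrix.sum_apply]; rfl
      calc l U = l U * mmap (chi U) i j := by rw [h1, mul_one]
        _ ≤ ∑ W, l W * mmap (chi W) i j :=
          Finset.single_le_sum (f := fun W => l W * mmap (chi W) i j)
            (fun W _ => nn i j W) (Finset.mem_univ U)
        _ ≤ ∑ j, ∑ W, l W * mmap (chi W) i j :=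
          Finset.single_le_sum (f := fun j => ∑ W, l W * mmap (chi W) i j)
            (fun j _ => Finset.sum_nonneg fun W _ => nn i j W) (Finset.mem_univ j)
        _ ≤ ∑ i, ∑ j, ∑ W, l W * mmap (chi W) i j :=
          Finset.single_le_sum (f := fun i => ∑ j, ∑ W, l W * mmap (chi W) i j)
            (fun i _ => Finset.sum_nonneg fun j _ => Finset.sum_nonneg fun W _ => nn i j W)
            (Finset.mem_univ i)
        _ ≤ K := by
          have : s (∑ W, l W • mmap (chi W)) = ∑ i, ∑ j, ∑ W, l W * mmap (chi W) i j := by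
            simp only [s, e]
          linarith
    refine ⟨fun U => if mmap (chi U) = 0 then 0 else l U, ?_, ?_⟩
    · intro U _
      by_cases h : mmap (chi U) = 0
      · simp [h, hK]
      · simp [h, hl U, h0 U h]
    · refine Finset.sum_congr rfl fun U _ => ?_
      by_cases h : mmap (chi U) = 0
      · simp [h]
      · simp [h]
  refine isClosed_of_closure_subset fun X hX => ?_
  let K := |s X| + 1
  have hK : 0 ≤ K := by positivity
  apply hBC K
  rw [← (hB K).closure_eq]
  have hO : IsOpen {Y | s Y < K} := isOpen_lt hs continuous_const
  have hXO : X ∈ {Y | s Y < K} := by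
    have := le_abs_self (s X)
    change s X < |s X| + 1
    linarith
  have := hO.inter_closure ⟨hXO, hX⟩
  exact closure_mono (fun Y hY => hCB K hK Y hY.2 hY.1) this

theorem Ebn_subset (n : ℕ) :
    Ebn n ⊆ {X | ∃ Y ∈ Pn n, ∃ Z ∈ cutCone n, X = Y + Z} := by
  rintro _ ⟨x, hx, rfl⟩
  rcases Nat.eq_zero_or_pos n with h0 | hpos
  · subst h0
    refine ⟨_, subset_convexHull ℝ _ ⟨1, rfl⟩, 0, ⟨0, by simp, by simp⟩, ?_⟩
    ext i
    exact i.elim0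
  let σ := Tuple.sort x
  have hσ : Monotone (x ∘ σ) := Tuple.monotone_sort x
  let π := σ.symm
  let g : ℕ → Fin n := fun i => ⟨min i (n-1), by omega⟩
  let a : ℕ → ℝ := fun i => x (σ (g i)) - ((g i : ℕ) + 1)
  have ha : Monotone a := by
    refine monotone_nat_of_le_succ fun i => ?_
    by_cases hi : i + 1 ≤ n - 1
    · have h1 : (g i : ℕ) = i := by simp only [g]; omega
      have h2 : (g (i+1) : ℕ) = i + 1 := by simp only [g]; omega
      have hle : g i ≤ g (i+1) := by rw [Fin.le_def]; omega
      have hne : g (i+1) ≠ g i := by rw [Ne, Fin.ext_iff]; omega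
      have h3 : x (σ (g i)) ≤ x (σ (g (i+1))) := hσ hle
      have h4 := hx (σ (g (i+1))) (σ (g i)) (fun h => hne (σ.injective h))
      rw [abs_of_nonneg (sub_nonneg.2 h3)] at h4
      simp only [a, h1, h2]
      push_cast
      linarith
    · have : g (i+1) = g i := by rw [Fin.ext_iff]; simp only [g]; omega
      simp only [a, this]; exact le_rfl
  have hg : ∀ j, g (π j : ℕ) = π j := by
    intro j; rw [Fin.ext_iff]; simp only [g]; omega
  have hxσ : ∀ j, σ (π j) = j := fun j => σ.apply_symm_apply j
  let y : Fin n → ℝ := fun j => x j - permVec π j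
  have hy : ∀ j, y j = a (π j : ℕ) := by
    intro j
    simp only [a, y, hg, hxσ, permVec]
  refine ⟨Mperm π, subset_convexHull ℝ _ ⟨π, rfl⟩, mmap y,
    mmap_mem_cutCone y a ha (fun j => π j) (fun j => (π j).2) hy, ?_⟩
  have main : ∀ k l, π k ≤ π l → |x k - x l| = |permVec π k - permVec π l| + |y k - y l| := by
    intro k l h
    have h1 : y k ≤ y l := by rw [hy, hy]; exact ha h
    have h2 : permVec π k ≤ permVec π l := by
      simp only [permVec]
      have : ((π k : ℕ) : ℝ) ≤ (π l : ℕ) := by exact_mod_cast h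
      linarith
    have h3 : x k ≤ x l := by simp only [y] at h1; linarith
    rw [abs_sub_comm, abs_of_nonneg (sub_nonneg.2 h3), abs_sub_comm,
      abs_of_nonneg (sub_nonneg.2 h2), abs_sub_comm, abs_of_nonneg (sub_nonneg.2 h1)]
    simp only [y]; ring
  ext k l
  change |x k - x l| = |permVec π k - permVec π l| + |y k - y l|
  rcases le_total (π k) (π l) with h | h
  · exact main k l h
  · rw [abs_sub_comm, main l k h, abs_sub_comm, abs_sub_comm (y l)]

theorem Mperm_mem (n : ℕ) (π : Equiv.Perm (Fin n)) : Mperm π ∈ Ebn n := by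
  refine ⟨permVec π, fun k l h => ?_, rfl⟩
  have h1 : (π k : ℕ) ≠ (π l : ℕ) := fun e => h (π.injective (Fin.ext e))
  have h2 : (1 : ℤ) ≤ |((π k : ℕ) : ℤ) - ((π l : ℕ) : ℤ)| := by
    apply Int.one_le_abs; omega
  have h3 : (1 : ℝ) ≤ |((π k : ℕ) : ℝ) - ((π l : ℕ) : ℝ)| := by exact_mod_cast h2
  simpa [permVec] using h3

theorem add_cut_mem (n : ℕ) (X : Matrix (Fin n) (Fin n) ℝ) (hX : X ∈ closure (Qn n))
    (t : ℝ) (ht : 0 ≤ t) (U : Finset (Fin n)) :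
    X + t • mmap (chi U) ∈ closure (Qn n) := by
  rcases ht.eq_or_lt with h | ht
  · subst h; simpa using hX
  have hconv : Convex ℝ (closure (Qn n)) := (convex_convexHull ℝ _).closure
  let x : Fin n → ℝ := permVec 1
  have hmm : ∀ (c : ℝ), 0 ≤ c → ∀ y : Fin n → ℝ, c • mmap y = mmap (c • y) := by
    intro c hc y
    ext k l
    simp only [Matrix.smul_apply, mmap, Pi.smul_apply, smul_eq_mul, ← mul_sub, abs_mul,
      abs_of_nonneg hc]
  have hE : ∀ s : ℝ, 2 * n + 1 ≤ s → mmap (x + s • chi U) ∈ Ebn n := by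
    intro s hs
    refine ⟨_, fun k l hkl => ?_, rfl⟩
    obtain ⟨z, hz, hz'⟩ := Mperm_mem n 1
    have h1 : 1 ≤ |x k - x l| := by
      have := hz k l hkl
      have e : |x k - x l| = |z k - z l| := congrFun (congrFun hz' k) l
      rwa [e]
    have hk : x k = (k : ℕ) + 1 := rfl
    have hl : x l = (l : ℕ) + 1 := rfl
    have hk2 : ((k : ℕ) : ℝ) ≤ n := by exact_mod_cast k.2.le
    have hl2 : ((l : ℕ) : ℝ) ≤ n := by exact_mod_cast l.2.le
    have hk3 : (0 : ℝ) ≤ ((k : ℕ) : ℝ) := by positivity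
    have hl3 : (0 : ℝ) ≤ ((l : ℕ) : ℝ) := by positivity
    simp only [Pi.add_apply, Pi.smul_apply, smul_eq_mul, chi]
    split_ifs
    · simpa using h1
    · rw [le_abs]; left; rw [hk, hl]; linarith
    · rw [le_abs]; right; rw [hk, hl]; linarith
    · simpa using h1
  let F : ℝ → Matrix (Fin n) (Fin n) ℝ := fun e => (1 - e) • X + mmap (e • x + t • chi U)
  have hF : Continuous F := by
    refine Continuous.add ?_ ((continuous_mmap n).comp ?_)
    · exact (continuous_const.sub continuous_id).smul continuous_const
    · exact (continuous_id.smul continuous_const).add continuous_const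
  have hF0 : F 0 = X + t • mmap (chi U) := by
    simp [F, hmm t ht.le]
  have hlim : Filter.Tendsto F (nhdsWithin 0 (Set.Ioi 0)) (nhds (F 0)) :=
    (hF.tendsto 0).mono_left nhdsWithin_le_nhds
  rw [← hF0]
  refine isClosed_closure.mem_of_tendsto hlim ?_
  have hpos : 0 < min 1 (t / (2 * n + 1)) := by positivity
  filter_upwards [Ioo_mem_nhdsGT hpos] with e he
  have he0 : 0 < e := he.1
  have he1 : e < 1 := lt_of_lt_of_le he.2 (min_le_left _ _)
  have he2 : e < t / (2 * n + 1) := lt_of_lt_of_le he.2 (min_le_right _ _)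
  have h2 : 2 * (n : ℝ) + 1 ≤ t / e := by
    rw [lt_div_iff₀ (by positivity)] at he2
    rw [le_div_iff₀ he0]
    linarith
  have h3 := hconv hX (subset_closure (subset_convexHull ℝ _ (hE _ h2)))
    (by linarith : 0 ≤ 1 - e) he0.le (by ring)
  rw [hmm e he0.le] at h3
  have h4 : e • (x + (t / e) • chi U) = e • x + t • chi U := by
    rw [smul_add, smul_smul, mul_div_cancel₀ _ he0.ne']
  rw [h4] at h3
  exact h3

theorem stmt7 (n : ℕ) (hn : 3 ≤ n) :
    closure (Qn n) = {X | ∃ Y ∈ Pn n, ∃ Z ∈ cutCone n, X = Y + Z} := by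
  classical
  apply Set.Subset.antisymm
  · have e : {X | ∃ Y ∈ Pn n, ∃ Z ∈ cutCone n, X = Y + Z} = Pn n + cutCone n := by
      ext X
      simp only [Set.mem_add, Set.mem_setOf_eq, eq_comm]
    have hsub := Ebn_subset n
    rw [e] at hsub ⊢
    have hfin : Set.Finite {X | ∃ π : Equiv.Perm (Fin n), X = Mperm π} := by
      refine (Set.finite_range (fun π : Equiv.Perm (Fin n) => Mperm π)).subset ?_
      rintro _ ⟨π, rfl⟩
      exact ⟨π, rfl⟩
    have hP : IsCompact (Pn n) := hfin.isCompact_convexHull ℝ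
    refine closure_minimal (convexHull_min hsub ?_) ?_
    · exact (convex_convexHull ℝ _).add (convex_cutCone n)
    · exact (isClosed_cutCone n).add_left_of_isCompact hP
  · rintro _ ⟨Y, hY, _, ⟨l, hl, rfl⟩, rfl⟩
    have hY' : Y ∈ closure (Qn n) := by
      apply subset_closure
      refine convexHull_mono ?_ hY
      rintro _ ⟨π, rfl⟩
      exact Mperm_mem n π
    have : ∀ S : Finset (Finset (Fin n)), Y + ∑ U ∈ S, l U • mmap (chi U) ∈ closure (Qn n) := by
      intro S
      induction S using Finset.induction_on with
      | empty => simpa using hY'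
      | insert U S hU ih =>
        rw [Finset.sum_insert hU, add_comm (l U • _), ← add_assoc]
        exact add_cut_mem n _ ih _ (hl U) U
    exact this _
end

section
/- Let n ≥ 3. The set of extreme points of the convex set Q_n is exactly {M(π) : π a permutation of [n]}. -/
open scoped BigOperators Pointwise

/-- Pseudo-metrics with off-diagonal entries at least one. -/
def metricSet (n : ℕ) : Set (Matrix (Fin n) (Fin n) ℝ) :=
  {X | (∀ k, X k k = 0) ∧ (∀ k l, X k l = X l k) ∧ (∀ k l, k ≠ l → 1 ≤ X k l) ∧
    ∀ k l m, X k m ≤ X k l + X l m}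

lemma metricSet_convex (n : ℕ) : Convex ℝ (metricSet n) := by
  rintro A ⟨hA0, hAs, hA1, hAt⟩ B ⟨hB0, hBs, hB1, hBt⟩ a b ha hb hab
  refine ⟨fun k => ?_, fun k l => ?_, fun k l h => ?_, fun k l m => ?_⟩
  · simp [hA0, hB0]
  · simp [hAs k l, hBs k l]
  · have h1 := mul_le_mul_of_nonneg_left (hA1 k l h) ha
    have h2 := mul_le_mul_of_nonneg_left (hB1 k l h) hb
    simp only [Matrix.add_apply, Matrix.smul_apply, smul_eq_mul]
    linarith
  · have h1 := mul_le_mul_of_nonneg_left (hAt k l m) ha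
    have h2 := mul_le_mul_of_nonneg_left (hBt k l m) hb
    simp only [Matrix.add_apply, Matrix.smul_apply, smul_eq_mul]
    linarith

lemma Qn_subset_metricSet (n : ℕ) : Qn n ⊆ metricSet n := by
  refine convexHull_min ?_ (metricSet_convex n)
  rintro X ⟨x, hx, rfl⟩
  refine ⟨fun k => by simp [mmap], fun k l => abs_sub_comm _ _, fun k l h => hx k l h,
    fun k l m => abs_sub_le _ _ _⟩

lemma one_le_abs_permVec {n : ℕ} (π : Equiv.Perm (Fin n)) (k l : Fin n) (h : k ≠ l) :
    1 ≤ |permVec π k - permVec π l| := by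
  have h1 : ((π k : ℕ) : ℤ) - (π l : ℕ) ≠ 0 := by
    intro h2
    apply h
    apply π.injective
    apply Fin.ext
    omega
  have h3 := Int.one_le_abs h1
  have h4 : ((1 : ℤ) : ℝ) ≤ ((|((π k : ℕ) : ℤ) - (π l : ℕ)| : ℤ) : ℝ) := by exact_mod_cast h3
  push_cast at h4
  simpa [permVec] using h4

lemma Mperm_mem_Ebn {n : ℕ} (π : Equiv.Perm (Fin n)) : Mperm π ∈ Ebn n :=
  ⟨permVec π, one_le_abs_permVec π, rfl⟩

lemma le_of_adjacent {n : ℕ} (π : Equiv.Perm (Fin n)) (A : Matrix (Fin n) (Fin n) ℝ)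
    (hA : A ∈ metricSet n) (h : ∀ k l, (π l : ℕ) = π k + 1 → A k l ≤ 1) :
    ∀ (d : ℕ) (k l : Fin n), (π l : ℕ) = π k + d → A k l ≤ d := by
  intro d
  induction d with
  | zero =>
    intro k l hkl
    have : k = l := π.injective (Fin.ext (by omega))
    subst this
    simp [hA.1]
  | succ d ih =>
    intro k l hkl
    have hlt : (π k : ℕ) + d < n := by have := (π l).2; omega
    have h1 := ih k (π.symm ⟨π k + d, hlt⟩) (by simp)
    have h2 := h (π.symm ⟨π k + d, hlt⟩) l (by simp; omega)
    have h3 := hA.2.2.2 k (π.symm ⟨π k + d, hlt⟩) l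
    push_cast
    linarith

lemma le_Mperm {n : ℕ} (π : Equiv.Perm (Fin n)) (A : Matrix (Fin n) (Fin n) ℝ)
    (hA : A ∈ metricSet n) (h : ∀ k l, (π l : ℕ) = π k + 1 → A k l ≤ 1) (k l : Fin n) :
    A k l ≤ Mperm π k l := by
  have key := le_of_adjacent π A hA h
  rcases le_total (π k : ℕ) (π l : ℕ) with hc | hc
  · have h1 := key (π l - π k) k l (by omega)
    rw [Nat.cast_sub hc] at h1
    refine h1.trans ?_
    have := neg_le_abs (permVec π k - permVec π l)
    simp only [Mperm, mmap, permVec] at *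
    linarith
  · have h1 := key (π k - π l) l k (by omega)
    rw [Nat.cast_sub hc, hA.2.1 l k] at h1
    refine h1.trans ?_
    have := le_abs_self (permVec π k - permVec π l)
    simp only [Mperm, mmap, permVec] at *
    linarith

lemma Mperm_adjacent {n : ℕ} (π : Equiv.Perm (Fin n)) (k l : Fin n)
    (h : (π l : ℕ) = π k + 1) : Mperm π k l = 1 := by
  simp [Mperm, mmap, permVec, h]

lemma Mperm_extreme {n : ℕ} (π : Equiv.Perm (Fin n)) :
    Mperm π ∈ Set.extremePoints ℝ (Qn n) := by
  rw [mem_extremePoints_iff_left]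
  refine ⟨subset_convexHull ℝ _ (Mperm_mem_Ebn π), ?_⟩
  rintro A hA B hB ⟨a, b, ha, hb, hab, hX⟩
  replace hA := Qn_subset_metricSet n hA
  replace hB := Qn_subset_metricSet n hB
  have hE : ∀ k l, a * A k l + b * B k l = Mperm π k l := by
    intro k l
    rw [← hX]
    simp
  have hne : ∀ k l, (π l : ℕ) = π k + 1 → k ≠ l := by
    rintro k l h rfl
    omega
  have hA1 : ∀ k l, (π l : ℕ) = π k + 1 → A k l ≤ 1 := by
    intro k l h
    have h1 := hE k l
    rw [Mperm_adjacent π k l h] at h1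
    have h3 := hB.2.2.1 k l (hne k l h)
    by_contra! h4
    nlinarith
  have hB1 : ∀ k l, (π l : ℕ) = π k + 1 → B k l ≤ 1 := by
    intro k l h
    have h1 := hE k l
    rw [Mperm_adjacent π k l h] at h1
    have h3 := hA.2.2.1 k l (hne k l h)
    by_contra! h4
    nlinarith
  ext k l
  have h1 := le_Mperm π A hA hA1 k l
  have h2 := le_Mperm π B hB hB1 k l
  have h3 := hE k l
  refine le_antisymm h1 ?_
  by_contra! h4
  have h5 : b = 1 - a := by linarith
  subst h5
  nlinarith

lemma exists_perm {n : ℕ} (x : Fin n → ℝ) (hx : ∀ k l : Fin n, k ≠ l → 1 ≤ |x k - x l|) :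
    ∃ π : Equiv.Perm (Fin n), ∀ k l, permVec π k ≤ permVec π l →
      permVec π l - permVec π k ≤ x l - x k := by
  refine ⟨(Tuple.sort x).symm, ?_⟩
  have hm : Monotone (x ∘ Tuple.sort x) := Tuple.monotone_sort x
  have key : ∀ (d : ℕ) (i j : Fin n), (j : ℕ) = i + d →
      (d : ℝ) ≤ x (Tuple.sort x j) - x (Tuple.sort x i) := by
    intro d
    induction d with
    | zero =>
      intro i j hij
      have : i = j := Fin.ext (by omega)
      subst this
      simp
    | succ d ih =>
      intro i j hij
      have hlt : (i : ℕ) + d < n := by have := j.2; omega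
      have h1 := ih i ⟨i + d, hlt⟩ rfl
      have hne : (⟨i + d, hlt⟩ : Fin n) ≠ j := by
        intro h
        have := congrArg Fin.val h
        simp at this
        omega
      have hle : (⟨i + d, hlt⟩ : Fin n) ≤ j := by
        rw [Fin.le_def]
        simp
        omega
      have h2 := hm hle
      have h3 := hx (Tuple.sort x j) (Tuple.sort x ⟨i + d, hlt⟩)
        (fun h => hne ((Tuple.sort x).injective h).symm)
      simp only [Function.comp] at h2
      rw [abs_of_nonneg (by linarith)] at h3
      push_cast
      linarith
  intro k l hkl
  have hc : ((Tuple.sort x).symm k : ℕ) ≤ ((Tuple.sort x).symm l : ℕ) := by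
    simp only [permVec] at hkl
    have : (((Tuple.sort x).symm k : ℕ) : ℝ) ≤ (((Tuple.sort x).symm l : ℕ) : ℝ) := by linarith
    exact_mod_cast this
  have h := key ((Tuple.sort x).symm l - (Tuple.sort x).symm k)
    ((Tuple.sort x).symm k) ((Tuple.sort x).symm l) (by omega)
  rw [Nat.cast_sub hc] at h
  simp only [Equiv.apply_symm_apply] at h
  simp only [permVec]
  linarith

lemma extreme_is_Mperm {n : ℕ} (X : Matrix (Fin n) (Fin n) ℝ)
    (hX : X ∈ Set.extremePoints ℝ (Qn n)) : ∃ π : Equiv.Perm (Fin n), X = Mperm π := by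
  obtain ⟨x, hx, rfl⟩ : X ∈ Ebn n := extremePoints_convexHull_subset hX
  obtain ⟨π, hπ⟩ := exists_perm x hx
  refine ⟨π, ?_⟩
  have habs : ∀ k l, |2 * x k - permVec π k - (2 * x l - permVec π l)| =
      2 * |x k - x l| - |permVec π k - permVec π l| ∧
      |permVec π k - permVec π l| ≤ |x k - x l| := by
    intro k l
    rcases le_total (permVec π k) (permVec π l) with hc | hc
    · have := hπ k l hc
      rw [abs_of_nonpos (by linarith), abs_of_nonpos (by linarith), abs_of_nonpos (by linarith)]
      constructor <;> linarith
    · have := hπ l k hc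
      rw [abs_of_nonneg (by linarith), abs_of_nonneg (by linarith), abs_of_nonneg (by linarith)]
      constructor <;> linarith
  rw [mem_extremePoints_iff_left] at hX
  refine (hX.2 (Mperm π) (subset_convexHull ℝ _ (Mperm_mem_Ebn π))
    (mmap fun k => 2 * x k - permVec π k) (subset_convexHull ℝ _ ⟨_, ?_, rfl⟩) ?_).symm
  · intro k l h
    have h1 := one_le_abs_permVec π k l h
    have h2 := habs k l
    linarith [h2.1, h2.2]
  · refine ⟨1 / 2, 1 / 2, by norm_num, by norm_num, by norm_num, ?_⟩
    ext k l
    simp only [Matrix.add_apply, Matrix.smul_apply, smul_eq_mul, Mperm, mmap]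
    rw [(habs k l).1]
    ring

theorem stmt9 (n : ℕ) (hn : 3 ≤ n) :
    Set.extremePoints ℝ (Qn n) = {X | ∃ π : Equiv.Perm (Fin n), X = Mperm π} := by
  ext X
  constructor
  · exact extreme_is_Mperm X
  · rintro ⟨π, rfl⟩
    exact Mperm_extreme π
end

section
/- Let n ≥ 3 and let X, Y be n×n real matrices with Y ≠ 0 such that the half-line X + ℝ≥0·Y = {X + t·Y : t ≥ 0} is an extreme subset of Q_n. Then there exist a permutation π of [n] and a nonempty proper subset U ⊊ [n] incident to π such that X + ℝ≥0·Y = M(π) + ℝ≥0·M(χ^U). -/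
open scoped BigOperators Pointwise

lemma mmap_add {n : ℕ} (σ : Equiv.Perm (Fin n)) (x y : Fin n → ℝ)
    (hx : ∀ k l, σ k ≤ σ l → x k ≤ x l) (hy : ∀ k l, σ k ≤ σ l → y k ≤ y l) :
    mmap (x + y) = mmap x + mmap y := by
  ext k l
  simp only [mmap, Matrix.add_apply, Pi.add_apply]
  rcases le_total (σ k) (σ l) with h | h
  · have h1 := hx _ _ h
    have h2 := hy _ _ h
    rw [abs_of_nonpos (by linarith), abs_of_nonpos (by linarith), abs_of_nonpos (by linarith)]
    ring
  · have h1 := hx _ _ h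
    have h2 := hy _ _ h
    rw [abs_of_nonneg (by linarith), abs_of_nonneg (by linarith), abs_of_nonneg (by linarith)]
    ring

lemma mmap_smul {n : ℕ} (c : ℝ) (hc : 0 ≤ c) (x : Fin n → ℝ) :
    mmap (c • x) = c • mmap x := by
  ext k l
  simp only [mmap, Matrix.smul_apply, Pi.smul_apply, smul_eq_mul]
  rw [← mul_sub, abs_mul, abs_of_nonneg hc]

lemma permVec_mono {n : ℕ} (σ : Equiv.Perm (Fin n)) (k l : Fin n) (h : σ k ≤ σ l) :
    permVec σ k ≤ permVec σ l := by
  simp only [permVec]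
  have : ((σ k : ℕ) : ℝ) ≤ ((σ l : ℕ) : ℝ) := by exact_mod_cast h
  linarith

lemma mem_E {n : ℕ} (σ : Equiv.Perm (Fin n)) (r : Fin n → ℝ)
    (hr : ∀ k l, σ k ≤ σ l → r k ≤ r l) : Mperm σ + mmap r ∈ Ebn n := by
  refine ⟨permVec σ + r, ?_, (mmap_add σ _ _ (permVec_mono σ) hr).symm⟩
  have key : ∀ k l, σ k < σ l → 1 ≤ (permVec σ + r) l - (permVec σ + r) k := by
    intro k l h
    have h1 := hr _ _ h.le
    have : ((σ k : ℕ) : ℝ) + 1 ≤ ((σ l : ℕ) : ℝ) := by exact_mod_cast h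
    simp only [permVec, Pi.add_apply]
    linarith
  intro k l hkl
  rcases lt_or_gt_of_ne (fun h => hkl (σ.injective h)) with h | h
  · rw [abs_sub_comm]
    exact (key _ _ h).trans (le_abs_self _)
  · exact (key _ _ h).trans (le_abs_self _)

lemma decomp_E {n : ℕ} (Z : Matrix (Fin n) (Fin n) ℝ) (hZ : Z ∈ Ebn n) :
    ∃ (σ : Equiv.Perm (Fin n)) (r : Fin n → ℝ), (∀ k l, σ k ≤ σ l → r k ≤ r l) ∧
      Z = Mperm σ + mmap r := by
  obtain ⟨z, hz, rfl⟩ := hZ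
  set σ : Equiv.Perm (Fin n) := (Tuple.sort z).symm with hσ
  have hm : Monotone (z ∘ Tuple.sort z) := Tuple.monotone_sort z
  have step : ∀ d : ℕ, ∀ i j : Fin n, (j : ℕ) = i + d →
      z (Tuple.sort z i) + d ≤ z (Tuple.sort z j) := by
    intro d
    induction d with
    | zero =>
      intro i j h
      have : j = i := Fin.ext (by simpa using h)
      simp [this]
    | succ d ih =>
      intro i j h
      have hj := j.2
      let p : Fin n := ⟨i + d, by omega⟩
      have h1 := ih i p rfl
      have hpj : p < j := by
        rw [Fin.lt_def]
        change (i : ℕ) + d < j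
        omega
      have h2 : z (Tuple.sort z p) ≤ z (Tuple.sort z j) := hm hpj.le
      have h3 := hz (Tuple.sort z j) (Tuple.sort z p)
        (fun h => hpj.ne' ((Tuple.sort z).injective h))
      rw [abs_of_nonneg (by linarith)] at h3
      push_cast
      linarith
  have hr : ∀ k l, σ k ≤ σ l → (z - permVec σ) k ≤ (z - permVec σ) l := by
    intro k l h
    have := step ((σ l : ℕ) - σ k) (σ k) (σ l) (by
      have : (σ k : ℕ) ≤ σ l := h
      omega)
    rw [Nat.cast_sub (by exact_mod_cast h)] at this
    simp only [hσ, Equiv.apply_symm_apply] at this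
    simp only [permVec, Pi.sub_apply, hσ]
    linarith
  refine ⟨σ, z - permVec σ, hr, ?_⟩
  rw [Mperm, ← mmap_add σ _ _ (permVec_mono σ) hr]
  congr 1
  ext k
  simp

lemma decomp_r {n : ℕ} (hn : 3 ≤ n) (σ : Equiv.Perm (Fin n)) (r : Fin n → ℝ)
    (hr : ∀ k l, σ k ≤ σ l → r k ≤ r l) (h0 : mmap r ≠ 0) :
    ∃ (U : Finset (Fin n)) (c : ℝ) (r' : Fin n → ℝ), incident σ U ∧ 0 < c ∧
      (∀ k l, σ k ≤ σ l → r' k ≤ r' l) ∧ mmap r = mmap r' + c • mmap (chi U) ∧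
      Mperm σ + (mmap r' + (2 * c) • mmap (chi U)) ∈ Ebn n := by
  obtain ⟨m, rfl⟩ : ∃ m, n = m + 1 := ⟨n - 1, by omega⟩
  obtain ⟨i, hi⟩ : ∃ i : Fin m, r (σ.symm i.castSucc) < r (σ.symm i.succ) := by
    by_contra hcon
    push Not at hcon
    have hanti : Antitone (fun i => r (σ.symm i)) := Fin.antitone_iff_succ_le.2 hcon
    apply h0
    have key : ∀ k l, σ k ≤ σ l → r k = r l := by
      intro k l h
      apply le_antisymm (hr _ _ h)
      simpa using hanti h
    ext k l
    simp only [mmap, Matrix.zero_apply, abs_eq_zero, sub_eq_zero]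
    rcases le_total (σ k) (σ l) with h | h
    · exact key _ _ h
    · exact (key _ _ h).symm
  set c := r (σ.symm i.succ) - r (σ.symm i.castSucc) with hc
  have hcpos : 0 < c := by linarith
  let U : Finset (Fin (m+1)) := Finset.univ.filter (fun j => σ j ≤ i.castSucc)
  have hU : ∀ j, j ∈ U ↔ σ j ≤ i.castSucc := fun j => by simp [U]
  let v : Fin (m+1) → ℝ := fun k => if σ k ≤ i.castSucc then 0 else 1
  have hv : ∀ k l, σ k ≤ σ l → v k ≤ v l := by
    intro k l h
    simp only [v]
    split_ifs with h1 h2 h2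
    · exact le_rfl
    · exact zero_le_one
    · exact absurd (h.trans h2) h1
    · exact le_rfl
  have hvU : mmap v = mmap (chi U) := by
    ext k l
    simp only [mmap, chi, v, hU]
    split_ifs <;> simp
  have hcv : ∀ a : ℝ, 0 ≤ a → ∀ k l, σ k ≤ σ l → (a • v) k ≤ (a • v) l := by
    intro a ha k l h
    exact mul_le_mul_of_nonneg_left (hv k l h) ha
  have hr' : ∀ k l, σ k ≤ σ l → (r - c • v) k ≤ (r - c • v) l := by
    intro k l h
    have h3 := hr k l h
    simp only [v, Pi.sub_apply, Pi.smul_apply, smul_eq_mul]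
    split_ifs with h1 h2 h2
    · linarith
    · have a1 : r k ≤ r (σ.symm i.castSucc) := hr _ _ (by simpa using h1)
      have a2 : r (σ.symm i.succ) ≤ r l := hr _ _ (by
        rw [Equiv.apply_symm_apply, ← Fin.castSucc_lt_iff_succ_le]
        exact not_le.1 h2)
      linarith
    · exact absurd (h.trans h2) h1
    · linarith
  have hcard : U.card = (i : ℕ) + 1 := by
    have : U = (Finset.Iic i.castSucc).map σ.symm.toEmbedding := by
      ext j
      simp [hU]
    rw [this, Finset.card_map, Fin.card_Iic]
    simp
  refine ⟨U, c, r - c • v, ⟨?_, ?_, ?_⟩, hcpos, hr', ?_, ?_⟩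
  · rw [← Finset.card_pos, hcard]
    omega
  · intro h
    rw [h, Finset.card_univ, Fintype.card_fin] at hcard
    omega
  · intro j
    rw [hU, hcard, Fin.le_def]
    simp
  · rw [← hvU, ← mmap_smul c hcpos.le, ← mmap_add σ _ _ hr' (hcv c hcpos.le)]
    congr 1
    simp
  · rw [← hvU, ← mmap_smul (2 * c) (by linarith), ← mmap_add σ _ _ hr' (hcv _ (by linarith))]
    apply mem_E
    intro k l h
    exact add_le_add (hr' k l h) (hcv _ (by linarith) k l h)

lemma face_sub {n : ℕ} (F : Set (Matrix (Fin n) (Fin n) ℝ)) (hF : IsExtreme ℝ (Qn n) F) :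
    F ⊆ convexHull ℝ (Ebn n ∩ F) := by
  have hcvx : Convex ℝ {Z | Z ∈ Qn n ∧ (Z ∈ F → Z ∈ convexHull ℝ (Ebn n ∩ F))} := by
    rw [convex_iff_openSegment_subset]
    rintro a ⟨ha, ha'⟩ b ⟨hb, hb'⟩ z hz
    refine ⟨(convex_convexHull ℝ _).openSegment_subset ha hb hz, fun hzF => ?_⟩
    have h1 := hF.2 ha hb hzF hz
    have h2 := hF.2 hb ha hzF (by rwa [openSegment_symm])
    exact (convex_convexHull ℝ _).openSegment_subset (ha' h1) (hb' h2) hz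
  have hsub : Ebn n ⊆ {Z | Z ∈ Qn n ∧ (Z ∈ F → Z ∈ convexHull ℝ (Ebn n ∩ F))} := by
    intro Z hZ
    exact ⟨subset_convexHull ℝ _ hZ, fun h => subset_convexHull ℝ _ ⟨hZ, h⟩⟩
  have := convexHull_min hsub hcvx
  intro Z hZ
  exact (this (hF.1 hZ)).2 hZ

lemma mid_mem {n : ℕ} (A B : Matrix (Fin n) (Fin n) ℝ) :
    A + B ∈ openSegment ℝ A (A + (2 : ℝ) • B) := by
  refine ⟨1/2, 1/2, by norm_num, by norm_num, by norm_num, ?_⟩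
  ext k l
  simp
  ring

def msum {n : ℕ} (Z : Matrix (Fin n) (Fin n) ℝ) : ℝ := ∑ k, ∑ l, Z k l

lemma msum_add {n : ℕ} (A B : Matrix (Fin n) (Fin n) ℝ) : msum (A + B) = msum A + msum B := by
  simp [msum, Finset.sum_add_distrib]

lemma msum_smul {n : ℕ} (c : ℝ) (A : Matrix (Fin n) (Fin n) ℝ) :
    msum (c • A) = c * msum A := by
  simp [msum, Finset.mul_sum]

lemma msum_perm {n : ℕ} (σ : Equiv.Perm (Fin n)) :
    msum (Mperm σ) = ∑ k : Fin n, ∑ l : Fin n, |((k : ℕ) : ℝ) - ((l : ℕ) : ℝ)| := by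
  simp only [msum, Mperm, mmap, permVec, add_sub_add_right_eq_sub]
  rw [← Equiv.sum_comp σ (fun k : Fin n => ∑ l : Fin n, |((k : ℕ) : ℝ) - ((l : ℕ) : ℝ)|)]
  refine Finset.sum_congr rfl fun k _ => ?_
  rw [← Equiv.sum_comp σ (fun l : Fin n => |((σ k : ℕ) : ℝ) - ((l : ℕ) : ℝ)|)]

lemma msum_pos {n : ℕ} (A : Matrix (Fin n) (Fin n) ℝ) (h : ∀ k l, 0 ≤ A k l) (h0 : A ≠ 0) :
    0 < msum A := by
  obtain ⟨k, l, hkl⟩ : ∃ k l, A k l ≠ 0 := by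
    by_contra hcon
    push Not at hcon
    exact h0 (by ext k l; exact hcon k l)
  refine Finset.sum_pos' (fun k _ => Finset.sum_nonneg fun l _ => h k l) ⟨k, Finset.mem_univ _, ?_⟩
  exact Finset.sum_pos' (fun l _ => h k l) ⟨l, Finset.mem_univ _, lt_of_le_of_ne (h k l) hkl.symm⟩

lemma Qn_nonneg {n : ℕ} (Z : Matrix (Fin n) (Fin n) ℝ) (hZ : Z ∈ Qn n) (k l : Fin n) :
    0 ≤ Z k l := by
  have hc : Convex ℝ {Z : Matrix (Fin n) (Fin n) ℝ | 0 ≤ Z k l} := by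
    intro a ha b hb s t hs ht _
    simp only [Set.mem_ofPred_eq, Matrix.add_apply, Matrix.smul_apply, smul_eq_mul] at *
    positivity
  refine convexHull_min ?_ hc hZ
  rintro _ ⟨z, _, rfl⟩
  exact abs_nonneg (z k - z l)

theorem stmt11 (n : ℕ) (hn : 3 ≤ n) (X Y : Matrix (Fin n) (Fin n) ℝ) (hY : Y ≠ 0)
    (hext : IsExtreme ℝ (Qn n) {Z | ∃ t : ℝ, 0 ≤ t ∧ Z = X + t • Y}) :
    ∃ π : Equiv.Perm (Fin n), ∃ U : Finset (Fin n), incident π U ∧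
      {Z | ∃ t : ℝ, 0 ≤ t ∧ Z = X + t • Y} = halfline π U := by
  set F : Set (Matrix (Fin n) (Fin n) ℝ) := {Z | ∃ t : ℝ, 0 ≤ t ∧ Z = X + t • Y} with hFdef
  have hEQ : Ebn n ⊆ Qn n := subset_convexHull ℝ _
  have hXF : X ∈ F := ⟨0, le_rfl, by simp⟩
  have hYnn : ∀ k l, 0 ≤ Y k l := by
    intro k l
    by_contra hneg
    push Not at hneg
    have hX0 := Qn_nonneg X (hext.1 hXF) k l
    have := Qn_nonneg (X + ((X k l + 1) / (- Y k l)) • Y)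
      (hext.1 ⟨_, div_nonneg (by linarith) (by linarith), rfl⟩) k l
    simp only [Matrix.add_apply, Matrix.smul_apply, smul_eq_mul] at this
    have h2 : (X k l + 1) / (- Y k l) * Y k l = -(X k l + 1) := by
      have := hneg.ne
      field_simp
    linarith
  have hYs := msum_pos Y hYnn hY
  -- X is a permutation point
  have hXext : ∀ A B, A ∈ Qn n → B ∈ Qn n → X ∈ openSegment ℝ A B → A = X := by
    intro A B hA hB hX
    obtain ⟨s, hs, rfl⟩ := hext.2 hA hB hXF hX
    obtain ⟨t, ht, rfl⟩ := hext.2 hB hA hXF (by rwa [openSegment_symm])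
    obtain ⟨a, b, ha, hb, hab, h⟩ := hX
    have h' := congrArg msum h
    simp only [msum_add, msum_smul] at h'
    have h3 : (a * s + b * t) * msum Y = 0 := by
      linear_combination h' - msum X * hab
    have h4 : a * s + b * t = 0 := by
      rcases mul_eq_zero.1 h3 with h | h
      · exact h
      · exact absurd h hYs.ne'
    have h5 : 0 ≤ b * t := by positivity
    have h6 : 0 ≤ a * s := by positivity
    have h7 : a * s = 0 := by linarith
    have : s = 0 := by
      rcases mul_eq_zero.1 h7 with h | h
      · exact absurd h ha.ne'
      · exact h
    simp [this]
  have hXE : X ∈ Ebn n := by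
    apply extremePoints_convexHull_subset (𝕜 := ℝ)
    refine ⟨hext.1 hXF, ?_⟩
    intro A hA B hB h
    exact hXext A B hA hB h
  have dbl : ∀ (σ : Equiv.Perm (Fin n)) (r : Fin n → ℝ), (∀ k l, σ k ≤ σ l → r k ≤ r l) →
      Mperm σ ∈ Ebn n ∧ Mperm σ + (2 : ℝ) • mmap r ∈ Ebn n := by
    intro σ r hr
    constructor
    · have := mem_E σ 0 (by simp)
      have h0 : mmap (0 : Fin n → ℝ) = 0 := by ext k l; simp [mmap]
      rwa [h0, add_zero] at this
    · rw [← mmap_smul 2 (by norm_num)]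
      apply mem_E
      intro k l h
      exact mul_le_mul_of_nonneg_left (hr k l h) (by norm_num)
  obtain ⟨π, r0, hr0, hX0⟩ := decomp_E X hXE
  have hXπ : Mperm π = X := by
    obtain ⟨h1, h2⟩ := dbl π r0 hr0
    apply hXext _ _ (hEQ h1) (hEQ h2)
    rw [hX0]
    exact mid_mem _ _
  obtain ⟨Z, ⟨hZE, hZF⟩, hZX⟩ : ∃ Z ∈ Ebn n ∩ F, Z ≠ X := by
    by_contra hcon
    push Not at hcon
    have h1 : X + Y ∈ F := ⟨1, zero_le_one, by simp⟩
    have h2 := convexHull_mono (𝕜 := ℝ) (t := {X}) hcon (face_sub F hext h1)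
    rw [convexHull_singleton] at h2
    exact hY (by simpa using h2)
  obtain ⟨σ, r, hr, rfl⟩ := decomp_E Z hZE
  obtain ⟨hs1, hs2⟩ := dbl σ r hr
  have hσF : Mperm σ ∈ F := hext.2 (hEQ hs1) (hEQ hs2) hZF (mid_mem _ _)
  have hσX : Mperm σ = X := by
    obtain ⟨t, ht, h⟩ := hσF
    have h' := congrArg msum h
    rw [← hXπ, msum_add, msum_smul, msum_perm, msum_perm] at h'
    have : t * msum Y = 0 := by linarith
    rcases mul_eq_zero.1 this with h0 | h0
    · rw [h, h0]; simp
    · exact absurd h0 hYs.ne'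
  have hr0' : mmap r ≠ 0 := by
    intro h
    exact hZX (by rw [h, add_zero, hσX])
  obtain ⟨U, c, r', hinc, hc, hr', hrr, hE2⟩ := decomp_r hn σ r hr hr0'
  refine ⟨σ, U, hinc, ?_⟩
  have hA0 : Mperm σ + mmap r' ∈ F := by
    refine hext.2 (hEQ (mem_E σ r' hr')) (hEQ hE2) hZF ?_
    have := mid_mem (Mperm σ + mmap r') (c • mmap (chi U))
    rw [hrr]
    rwa [smul_smul, add_assoc, add_assoc] at this
  obtain ⟨t0, ht0, h0⟩ := hA0
  obtain ⟨t1, ht1, h1⟩ := hZF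
  have hcut : c • mmap (chi U) = (t1 - t0) • Y := by
    rw [hrr, ← add_assoc, h0] at h1
    rw [sub_smul, eq_sub_iff_add_eq]
    have := add_left_cancel ((add_assoc X _ _).symm.trans h1)
    rw [add_comm, this]
  have hcs : 0 < msum (mmap (chi U)) := by
    apply msum_pos
    · intro k l
      exact abs_nonneg _
    · intro h
      obtain ⟨k, hk⟩ := hinc.1
      obtain ⟨l, hl⟩ : ∃ l, l ∉ U := by
        by_contra hcon
        push Not at hcon
        exact hinc.2.1 (Finset.eq_univ_iff_forall.2 hcon)
      have := congrFun (congrFun h k) l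
      simp [mmap, chi, hk, hl] at this
  have hd : 0 < t1 - t0 := by
    have h' := congrArg msum hcut
    rw [msum_smul, msum_smul] at h'
    by_contra hneg
    push Not at hneg
    have e1 : 0 < c * msum (mmap (chi U)) := by positivity
    have e2 := mul_nonpos_of_nonpos_of_nonneg hneg hYs.le
    linarith
  ext W
  constructor
  · rintro ⟨t, ht, rfl⟩
    refine ⟨t / (t1 - t0) * c, by positivity, ?_⟩
    rw [hσX, mul_smul, hcut, smul_smul, div_mul_cancel₀ _ hd.ne']
  · rintro ⟨t, ht, rfl⟩
    refine ⟨t / c * (t1 - t0), by positivity, ?_⟩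
    rw [hσX, mul_smul, ← hcut, smul_smul, div_mul_cancel₀ _ hc.ne']
end
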